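/- arXiv:1408.4403 — 3 statements merged into one kernel-verified Lean document; each statement's English description precedes it below -/
import Mathlib

section
/- Fix 0 < q < 1 and θ = π/4. Let N > f ≥ 1 be integers and u₁,…,u_f ∈ ℂ; define Q(u) = Π_{j=1}^f θ1(u−u_j), Φ(u) = θ1(u)^{N−f}, and 𝔱 = (−1)^f Q(θ)/Q(−θ), and assume Q(θ), Q(2θ), Q(−θ) are all nonzero. Define T₁(u) = [ Φ(u+θ)Q(u+θ) + (−1)^{N+1} 𝔱 Φ(u−θ)Q(u−θ) ] / Q(u) at points where Q(u) ≠ 0, and T₂(u) = T₁(u)T₁(u+θ) + (−1)^N 𝔱 Φ(u)Φ(u+θ). Then T₂(θ) = 𝔱^{−1} Φ(θ) Φ(2θ). -/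
/-- The Jacobi theta function `θ₁(u,q) = −i Σ_{j∈ℤ} (−1)^j q^{(j+1/2)²} e^{(2j+1)iu}`. -/
noncomputable def th1 (q u : ℂ) : ℂ :=
  -Complex.I * ∑' j : ℤ, (-1 : ℂ) ^ j * q ^ (((j : ℂ) + 1 / 2) ^ 2) *
    Complex.exp ((2 * (j : ℂ) + 1) * Complex.I * u)

/-- The Jacobi theta function `θ₄(u,q) = Σ_{j∈ℤ} (−1)^j q^{j²} e^{2iju}`. -/
noncomputable def th4 (q u : ℂ) : ℂ :=
  ∑' j : ℤ, (-1 : ℂ) ^ j * q ^ ((j : ℂ) ^ 2) * Complex.exp (2 * (j : ℂ) * Complex.I * u)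

/-- `θ = π/4`. -/
noncomputable def thet : ℂ := (Real.pi : ℂ) / 4

/-- The Q-function `Q(w) = Π_{j=1}^f θ₁(w − u_j)` of a set of Bethe roots. -/
noncomputable def Qfun (q : ℂ) {f : ℕ} (u : Fin f → ℂ) (w : ℂ) : ℂ :=
  ∏ j, th1 q (w - u j)

/-- `Φ(w) = θ₁(w)^m` (with `m = N − f`). -/
noncomputable def Phi (q : ℂ) (m : ℕ) (w : ℂ) : ℂ := th1 q w ^ m

/-- The function `T₁` of the T-Q system. -/
noncomputable def T1 (q : ℂ) (N : ℕ) {f : ℕ} (u : Fin f → ℂ) (tf w : ℂ) : ℂ :=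
  (Phi q (N - f) (w + thet) * Qfun q u (w + thet) +
      (-1 : ℂ) ^ (N + 1) * tf * Phi q (N - f) (w - thet) * Qfun q u (w - thet)) /
    Qfun q u w

/-- The function `T₂` of the T-Q system. -/
noncomputable def T2 (q : ℂ) (N : ℕ) {f : ℕ} (u : Fin f → ℂ) (tf w : ℂ) : ℂ :=
  T1 q N u tf w * T1 q N u tf (w + thet) +
    (-1 : ℂ) ^ N * tf * Phi q (N - f) w * Phi q (N - f) (w + thet)

/-- `θ₁` is odd: reindex the series by `j ↦ -1 - j`. -/
theorem th1_neg (q u : ℂ) : th1 q (-u) = -th1 q u := by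
  unfold th1
  rw [← (Equiv.subLeft (-1 : ℤ)).tsum_eq, ← mul_neg, ← tsum_neg]
  congr 1
  refine tsum_congr fun j => ?_
  have hs : (-1 : ℂ) ^ (-1 - j) = -(-1 : ℂ) ^ j := by
    rw [zpow_sub₀ (by norm_num), div_eq_mul_inv, ← inv_zpow]
    norm_num
  have hq : (((-1 - j : ℤ) : ℂ) + 1 / 2) ^ 2 = ((j : ℂ) + 1 / 2) ^ 2 := by
    push_cast
    ring
  have he : (2 * ((-1 - j : ℤ) : ℂ) + 1) * Complex.I * -u =
      (2 * (j : ℂ) + 1) * Complex.I * u := by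
    push_cast
    ring
  rw [Equiv.subLeft_apply, hs, hq, he]
  ring

theorem th1_zero (q : ℂ) : th1 q 0 = 0 := by
  have h := th1_neg q 0
  rw [neg_zero] at h
  exact self_eq_neg.mp h

theorem th1_add_pi (q u : ℂ) : th1 q (u + Real.pi) = -th1 q u := by
  unfold th1
  rw [← mul_neg, ← tsum_neg]
  congr 1
  refine tsum_congr fun j => ?_
  have he : Complex.exp ((2 * (j : ℂ) + 1) * Complex.I * (u + Real.pi)) =
      -Complex.exp ((2 * (j : ℂ) + 1) * Complex.I * u) := by
    have h : (2 * (j : ℂ) + 1) * Complex.I * (u + Real.pi) =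
        (2 * (j : ℂ) + 1) * Complex.I * u + Real.pi * Complex.I
          + j * (2 * Real.pi * Complex.I) := by
      ring
    rw [h, Complex.exp_add, Complex.exp_int_mul_two_pi_mul_I, Complex.exp_add,
      Complex.exp_pi_mul_I]
    ring
  rw [he]
  ring

theorem Phi_zero (q : ℂ) {m : ℕ} (hm : m ≠ 0) : Phi q m 0 = 0 := by
  rw [Phi, th1_zero, zero_pow hm]

theorem Phi_pi_sub (q : ℂ) (m : ℕ) (w : ℂ) : Phi q m (Real.pi - w) = Phi q m w := by
  rw [Phi, Phi, sub_eq_neg_add, th1_add_pi, th1_neg, neg_neg]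

theorem Qfun_add_pi (q : ℂ) {f : ℕ} (u : Fin f → ℂ) (w : ℂ) :
    Qfun q u (w + Real.pi) = (-1 : ℂ) ^ f * Qfun q u w := by
  simp only [Qfun, add_sub_right_comm, th1_add_pi, Finset.prod_neg, Finset.card_univ,
    Fintype.card_fin]

/-- in the T-Q system of the staggered M₂ model with
`𝔱 = (−1)^f Q(θ)/Q(−θ)` and `Q(θ), Q(2θ), Q(−θ) ≠ 0`, one has
`T₂(θ) = 𝔱⁻¹ Φ(θ) Φ(2θ)`. -/
theorem stmt14 (q : ℝ) (hq : 0 < q) (hq1 : q < 1) (N f : ℕ) (hf : 1 ≤ f) (hfN : f < N)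
    (u : Fin f → ℂ)
    (hQt : Qfun (q : ℂ) u thet ≠ 0) (hQ2t : Qfun (q : ℂ) u (2 * thet) ≠ 0)
    (hQmt : Qfun (q : ℂ) u (-thet) ≠ 0)
    (tf : ℂ) (htf : tf = (-1 : ℂ) ^ f * Qfun (q : ℂ) u thet / Qfun (q : ℂ) u (-thet)) :
    T2 (q : ℂ) N u tf thet = tf⁻¹ * Phi (q : ℂ) (N - f) thet * Phi (q : ℂ) (N - f) (2 * thet) := by
  have h3 : 2 * thet + thet = Real.pi - thet := by
    unfold thet
    ring
  have hPhi : Phi (q : ℂ) (N - f) (2 * thet + thet) = Phi (q : ℂ) (N - f) thet := by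
    rw [h3, Phi_pi_sub]
  have hQ : Qfun (q : ℂ) u (2 * thet + thet) = (-1 : ℂ) ^ f * Qfun (q : ℂ) u (-thet) := by
    rw [h3, sub_eq_neg_add, Qfun_add_pi]
  have h0 : Phi (q : ℂ) (N - f) 0 = 0 := Phi_zero _ (Nat.sub_ne_zero_of_lt hfN)
  have h1 : T1 (q : ℂ) N u tf thet =
      Phi (q : ℂ) (N - f) (2 * thet) * Qfun (q : ℂ) u (2 * thet) / Qfun (q : ℂ) u thet := by
    rw [T1, sub_self, h0, ← two_mul]
    ring
  have h2 : T1 (q : ℂ) N u tf (2 * thet) =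
      (Phi (q : ℂ) (N - f) thet * ((-1 : ℂ) ^ f * Qfun (q : ℂ) u (-thet)) +
        (-1 : ℂ) ^ (N + 1) * tf * Phi (q : ℂ) (N - f) thet * Qfun (q : ℂ) u thet) /
        Qfun (q : ℂ) u (2 * thet) := by
    rw [T1, hPhi, hQ, show 2 * thet - thet = thet by ring]
  have hinv : tf⁻¹ = (-1 : ℂ) ^ f * Qfun (q : ℂ) u (-thet) / Qfun (q : ℂ) u thet := by
    rw [htf, inv_div, ← div_div, div_eq_mul_inv _ ((-1 : ℂ) ^ f), ← inv_pow]
    norm_num [mul_comm]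
  rw [T2, ← two_mul, h1, h2, hinv]
  field_simp
  ring
end

section
/- Fix 0 < q < 1 and θ = π/4, and let N ≥ 2 be an even integer. Define ℛ(u) = ( θ1(u) θ1(u−2θ) )^{N/2}. Then for every u ∈ ℂ: ℛ(u+θ) = (−1)^{N/2} ℛ(u−θ). Consequently ℛ solves the ground-state functional equation 0 = ℛ(u+θ) + (−1)^{N+1} 𝔱 ℛ(u−θ) with 𝔱 = 1 when N ≡ 0 (mod 4) and with 𝔱 = −1 when N ≡ 2 (mod 4); its Q-function part has all N/2 Bethe roots located at the single point u = 2θ = π/2. -/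
/-- `ℛ(w) = (θ₁(w) θ₁(w − 2θ))^{N/2}`. -/
noncomputable def RG (q : ℂ) (m : ℕ) (w : ℂ) : ℂ := (th1 q w * th1 q (w - 2 * thet)) ^ m

theorem RG_add_thet (q : ℂ) (m : ℕ) (w : ℂ) :
    RG q m (w + thet) = (-1 : ℂ) ^ m * RG q m (w - thet) := by
  have h₁ : w + thet = w - thet - 2 * thet + Real.pi := by
    unfold thet; ring
  have h₂ : w + thet - 2 * thet = w - thet := by ring
  rw [RG, RG, h₂, h₁, th1_add_pi, ← mul_pow]
  congr 1
  ring

/-- for even `N`, `ℛ(u) = (θ₁(u)θ₁(u−2θ))^{N/2}` satisfies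
`ℛ(u+θ) = (−1)^{N/2} ℛ(u−θ)`; consequently it solves the ground-state functional
equation `0 = ℛ(u+θ) + (−1)^{N+1} 𝔱 ℛ(u−θ)` with `𝔱 = 1` when `N ≡ 0 (mod 4)` and
`𝔱 = −1` when `N ≡ 2 (mod 4)`. -/
theorem stmt16 (q : ℝ) (hq : 0 < q) (hq1 : q < 1) (N : ℕ) (hN : 2 ≤ N) (hNe : Even N) :
    (∀ w : ℂ, RG (q : ℂ) (N / 2) (w + thet) = (-1 : ℂ) ^ (N / 2) * RG (q : ℂ) (N / 2) (w - thet)) ∧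
    (N % 4 = 0 → ∀ w : ℂ,
      (0 : ℂ) = RG (q : ℂ) (N / 2) (w + thet) +
        (-1 : ℂ) ^ (N + 1) * 1 * RG (q : ℂ) (N / 2) (w - thet)) ∧
    (N % 4 = 2 → ∀ w : ℂ,
      (0 : ℂ) = RG (q : ℂ) (N / 2) (w + thet) +
        (-1 : ℂ) ^ (N + 1) * (-1) * RG (q : ℂ) (N / 2) (w - thet)) := by
  refine ⟨RG_add_thet _ _, fun h w => ?_, fun h w => ?_⟩
  · have hm : Even (N / 2) := Nat.even_iff.mpr (by lia)
    rw [RG_add_thet, hm.neg_one_pow, hNe.add_one.neg_one_pow]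
    ring
  · have hm : Odd (N / 2) := Nat.odd_iff.mpr (by lia)
    rw [RG_add_thet, hm.neg_one_pow, hNe.add_one.neg_one_pow]
    ring
end

section
/- Fix 0 < q < 1 and θ = π/4, and set z(u) = −θ1(u+θ)/θ1(u−θ). Let N > f ≥ 1 be integers and suppose u₁,…,u_f ∈ ℂ solve the Bethe equations of the staggered M₂ model with zero twist: z(u_k)^{N−f} = Π_{j=1}^f [θ1(u_j−θ)/θ1(u_j+θ)] · [θ1(u_k−u_j−θ)/θ1(u_k−u_j+θ)] for each k ∈ {1,…,f}, where all theta factors appearing (including θ1(u_j±θ) and θ1(u_k−u_j±θ)) are nonzero. Set u_{f+1} = 0, and assume θ1(u_j ± θ) ≠ 0 and θ1(u_k − u_j ± θ) ≠ 0 for all 1 ≤ j, k ≤ f+1. Then u₁,…,u_f, u_{f+1} solve the Bethe equations with f replaced by f+1 on the same chain of N sites: z(u_k)^{N−f−1} = Π_{j=1}^{f+1} [θ1(u_j−θ)/θ1(u_j+θ)] · [θ1(u_k−u_j−θ)/θ1(u_k−u_j+θ)] for each k ∈ {1,…,f+1}. In particular, z(0) = 1, so the added root carries no momentum, and this realises the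 action of the adjoint supercharge Q̄₊ on Bethe states. -/
/-- The elliptic rapidity `z(u) = −θ₁(u+θ)/θ₁(u−θ)`. -/
noncomputable def zrap (q u : ℂ) : ℂ := -th1 q (u + thet) / th1 q (u - thet)

/-- A root at the origin carries no momentum. -/
theorem zrap_zero (q : ℂ) (h : th1 q thet ≠ 0) : zrap q 0 = 1 := by
  rw [zrap, zero_add, zero_sub, th1_neg, neg_div_neg_eq, div_self h]

/-- if `u₁, …, u_f` solve the Bethe equations of the staggered M₂ model
with `f` particles on `N` sites and zero twist, then adding the extra root
`u_{f+1} = 0` yields a solution of the Bethe equations with `f+1` particles on the same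
chain; moreover `z(0) = 1`, so the added root carries no momentum.  This realises the
action of the adjoint supercharge `Q̄₊` on Bethe states. -/
theorem stmt19 (q : ℝ) (hq : 0 < q) (hq1 : q < 1) (N f : ℕ) (hf : 1 ≤ f) (hfN : f < N)
    (u : ℕ → ℂ) (hlast : u (f + 1) = 0)
    (hnz1 : ∀ j ∈ Finset.Icc 1 (f + 1),
      th1 (q : ℂ) (u j - thet) ≠ 0 ∧ th1 (q : ℂ) (u j + thet) ≠ 0)
    (hnz2 : ∀ j ∈ Finset.Icc 1 (f + 1), ∀ k ∈ Finset.Icc 1 (f + 1),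
      th1 (q : ℂ) (u k - u j - thet) ≠ 0 ∧ th1 (q : ℂ) (u k - u j + thet) ≠ 0)
    (hBA : ∀ k ∈ Finset.Icc 1 f,
      zrap (q : ℂ) (u k) ^ (N - f) =
        ∏ j ∈ Finset.Icc 1 f,
          th1 (q : ℂ) (u j - thet) / th1 (q : ℂ) (u j + thet) *
            (th1 (q : ℂ) (u k - u j - thet) / th1 (q : ℂ) (u k - u j + thet))) :
    (∀ k ∈ Finset.Icc 1 (f + 1),
      zrap (q : ℂ) (u k) ^ (N - (f + 1)) =
        ∏ j ∈ Finset.Icc 1 (f + 1),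
          th1 (q : ℂ) (u j - thet) / th1 (q : ℂ) (u j + thet) *
            (th1 (q : ℂ) (u k - u j - thet) / th1 (q : ℂ) (u k - u j + thet))) ∧
    zrap (q : ℂ) 0 = 1 := by
  have hθ : th1 (q : ℂ) thet ≠ 0 := by
    simpa [hlast] using (hnz1 (f + 1) (by simp)).2
  refine ⟨fun k hk => ?_, zrap_zero _ hθ⟩
  rw [Finset.mem_Icc] at hk
  rcases Nat.lt_succ_iff_lt_or_eq.mp (Nat.lt_succ_of_le hk.2) with hkf | rfl
  · obtain ⟨hm, hp⟩ := hnz1 k (Finset.mem_Icc.mpr hk)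
    have hz : zrap (q : ℂ) (u k) ≠ 0 := div_ne_zero (neg_ne_zero.mpr hp) hm
    rw [Finset.prod_Icc_succ_top (by omega),
      ← hBA k (Finset.mem_Icc.mpr ⟨hk.1, by omega⟩), hlast, zero_sub, zero_add, sub_zero,
      th1_neg, neg_div, div_self hθ, show N - f = N - (f + 1) + 1 by omega, pow_succ,
      mul_assoc, eq_comm]
    convert mul_one _ using 2
    unfold zrap
    field_simp
  · rw [hlast, zrap_zero _ hθ, one_pow, eq_comm]
    refine Finset.prod_eq_one fun j hj => ?_
    obtain ⟨hm, hp⟩ := hnz1 j hj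
    rw [show 0 - u j - thet = -(u j + thet) by ring,
      show 0 - u j + thet = -(u j - thet) by ring, th1_neg, th1_neg]
    field_simp
end
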